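/- Both Ψ₁ = θ − φζ₁(z,τ) and Ψ₂ = φ·∂_τζ₁(z,τ) + θ·∂_zζ₁(z,τ) are invariant under the two transformations (z,θ) ↦ (z+1,θ) and (z,θ) ↦ (z+τ+θφ, θ+φ). -/

import Mathlib

noncomputable section
open Complex

/-- `2πi` as a complex number. -/
def i2pi : ℂ := 2 * (Real.pi : ℂ) * Complex.I

/-- membership in the lattice `ℤ + ℤτ`. -/
def lat (τ z : ℂ) : Prop := ∃ m n : ℤ, z = (m : ℂ) + (n : ℂ) * τ

/-- the lattice point `m + nτ`. -/
def latPt (τ : ℂ) (p : ℤ × ℤ) : ℂ := (p.1 : ℂ) + (p.2 : ℂ) * τ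

/-- The Weierstrass zeta function of the lattice `ℤ + ℤτ`. -/
def wzeta (τ z : ℂ) : ℂ :=
  1 / z + ∑' p : {p : ℤ × ℤ // p ≠ 0},
    (1 / (z - latPt τ p) + 1 / latPt τ p + z / (latPt τ p) ^ 2)

/-- The Weierstrass ℘-function, `℘ = -∂_z ζ`. -/
def wp (τ z : ℂ) : ℂ := - deriv (wzeta τ) z

/-- The quasi-period `η₁(τ) = ζ(z+1,τ) - ζ(z,τ)` (evaluated at `z = -1/2`). -/
def eta1 (τ : ℂ) : ℂ := wzeta τ (1 / 2) - wzeta τ (-(1 / 2))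

/-- The quasi-period `η₂(τ) = ζ(z+τ,τ) - ζ(z,τ)` (evaluated at `z = -τ/2`). -/
def eta2 (τ : ℂ) : ℂ := wzeta τ (τ / 2) - wzeta τ (-(τ / 2))

/-- `ζ₁(z,τ) = (-2πi)⁻¹ (ζ(z,τ) - η₁(τ) z)`. -/
def zeta1 (τ z : ℂ) : ℂ := (-i2pi)⁻¹ * (wzeta τ z - eta1 τ * z)

/-- Normalized Eisenstein series of weight 2. -/
def E2 (q : ℂ) : ℂ := 1 - 24 * ∑' n : ℕ+, ((n : ℕ) : ℂ) * q ^ (n : ℕ) / (1 - q ^ (n : ℕ))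

/-- Normalized Eisenstein series of weight 4. -/
def E4 (q : ℂ) : ℂ := 1 + 240 * ∑' n : ℕ+, ((n : ℕ) : ℂ) ^ 3 * q ^ (n : ℕ) / (1 - q ^ (n : ℕ))

/-- Normalized Eisenstein series of weight 6. -/
def E6 (q : ℂ) : ℂ := 1 - 504 * ∑' n : ℕ+, ((n : ℕ) : ℂ) ^ 5 * q ^ (n : ℕ) / (1 - q ^ (n : ℕ))

/-- `g₂(τ) = (2πi)⁴ E₄(q)/12`. -/
def g2 (τ : ℂ) : ℂ := i2pi ^ 4 * E4 (Complex.exp (i2pi * τ)) / 12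

/-- `g₃(τ) = -(2πi)⁶ E₆(q)/216`. -/
def g3 (τ : ℂ) : ℂ := -(i2pi ^ 6) * E6 (Complex.exp (i2pi * τ)) / 216

/-- A superfunction `f = a(z) + φ b(z) + θ c(z) + θφ d(z)` on `ℂ^{1|1}` with an
extra odd parameter `φ`, recorded by its four coefficient functions. -/
structure SF where
  a : ℂ → ℂ
  b : ℂ → ℂ
  c : ℂ → ℂ
  d : ℂ → ℂ

/-- Pullback by the transformation `(z,θ) ↦ (z+1, θ)`. -/
def T1 (f : SF) : SF :=
  ⟨fun z => f.a (z + 1), fun z => f.b (z + 1), fun z => f.c (z + 1), fun z => f.d (z + 1)⟩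

/-- Pullback by the transformation `(z,θ) ↦ (z+τ+θφ, θ+φ)`, expanded using the
nilpotency of `θ` and `φ`. -/
def T2 (τ : ℂ) (f : SF) : SF :=
  ⟨fun z => f.a (z + τ),
   fun z => f.b (z + τ) + f.c (z + τ),
   fun z => f.c (z + τ),
   fun z => f.d (z + τ) + deriv f.a (z + τ)⟩

/-- The odd vector field `D = ∂_θ + θ∂_z` acting on superfunctions. -/
def Dop (f : SF) : SF := ⟨f.c, f.d, deriv f.a, deriv f.b⟩

/-- Pointwise (componentwise) equality of superfunctions at `z`. -/
def SF.EqAt (f g : SF) (z : ℂ) : Prop :=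
  f.a z = g.a z ∧ f.b z = g.b z ∧ f.c z = g.c z ∧ f.d z = g.d z

/-- `Ψ₁ = θ - φ ζ₁(z,τ)`. -/
def Psi1 (τ : ℂ) : SF :=
  ⟨fun _ => 0, fun z => -(zeta1 τ z), fun _ => 1, fun _ => 0⟩

/-- `Ψ₂ = φ ∂_τζ₁(z,τ) + θ ∂_zζ₁(z,τ)`. -/
def Psi2 (τ : ℂ) : SF :=
  ⟨fun _ => 0, fun z => deriv (fun t => zeta1 t z) τ, fun z => deriv (zeta1 τ) z, fun _ => 0⟩

open Filter Topology in
lemma aux_lowbd (τ : ℂ) (hτ : 0 < τ.im) : ∃ c > 0, ∀ p : ℤ × ℤ, c * ‖p‖ ≤ ‖latPt τ p‖ := by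
  have hK : 0 < 1 + ‖τ‖ / τ.im := by positivity
  refine ⟨min τ.im (1 + ‖τ‖ / τ.im)⁻¹, by positivity, fun p => ?_⟩
  have h2 : |(p.2 : ℝ)| * τ.im ≤ ‖latPt τ p‖ := by
    have := Complex.abs_im_le_norm (latPt τ p)
    simpa [latPt, abs_mul, abs_of_pos hτ] using this
  have h1 : |(p.1 : ℝ)| ≤ ‖latPt τ p‖ * (1 + ‖τ‖ / τ.im) := by
    have e : (p.1 : ℂ) = latPt τ p - p.2 * τ := by simp [latPt]
    have := norm_sub_le (latPt τ p) (p.2 * τ)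
    rw [← e, norm_mul] at this
    simp only [Complex.norm_intCast] at this
    have h3 : |(p.2 : ℝ)| ≤ ‖latPt τ p‖ / τ.im := by rwa [le_div_iff₀ hτ]
    have h4 : |(p.2 : ℝ)| * ‖τ‖ ≤ ‖latPt τ p‖ / τ.im * ‖τ‖ := by gcongr
    calc _ ≤ _ := this
      _ ≤ ‖latPt τ p‖ + ‖latPt τ p‖ / τ.im * ‖τ‖ := by gcongr
      _ = _ := by ring
  rw [Prod.norm_def]
  rcases max_choice ‖p.1‖ ‖p.2‖ with h | h <;> rw [h, Int.norm_eq_abs]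
  · calc _ ≤ (1 + ‖τ‖ / τ.im)⁻¹ * |(p.1 : ℝ)| := by gcongr; exact min_le_right _ _
      _ ≤ _ := by rw [inv_mul_le_iff₀ hK]; linarith
  · calc _ ≤ τ.im * |(p.2 : ℝ)| := by gcongr; exact min_le_left _ _
      _ ≤ _ := by linarith

lemma aux_one_le_norm (p : ℤ × ℤ) (hp : p ≠ 0) : 1 ≤ ‖p‖ := by
  rw [Prod.norm_def, le_max_iff]
  by_contra! h
  apply hp
  have h1 := h.1
  have h2 := h.2
  rw [Int.norm_eq_abs] at h1 h2
  norm_cast at h1 h2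
  ext
  · simpa using h1
  · simpa using h2

lemma aux_latPt_shift (τ t z w : ℂ) (p : ℤ × ℤ) (ε : ℝ) (h1 : ‖t - τ‖ ≤ ε) (h2 : ‖w - z‖ ≤ ε) :
    ‖(w - latPt t p) - (z - latPt τ p)‖ ≤ ε * (1 + ‖p‖) := by
  have e : (w - latPt t p) - (z - latPt τ p) = (w - z) - p.2 * (t - τ) := by
    simp [latPt]; ring
  rw [e]
  have h3 : |(p.2 : ℝ)| ≤ ‖p‖ := by
    rw [← Int.norm_eq_abs]; exact norm_snd_le p
  have h0 : 0 ≤ ε := (norm_nonneg _).trans h1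
  calc _ ≤ ‖w - z‖ + ‖(p.2 : ℂ) * (t - τ)‖ := norm_sub_le _ _
    _ ≤ ε + ‖p‖ * ε := by
      rw [norm_mul, Complex.norm_intCast]
      gcongr
    _ = _ := by ring

lemma aux_lowbd2 (τ : ℂ) (hτ : 0 < τ.im) (z : ℂ) (hz : ¬ lat τ z) :
    ∃ c > 0, ∀ p : ℤ × ℤ, c * (1 + ‖p‖) ≤ ‖z - latPt τ p‖ := by
  obtain ⟨c, hc, h⟩ := aux_lowbd τ hτ
  -- large p
  set K : ℝ := (2 * ‖z‖ + c) / c with hK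
  have hfin : (Metric.closedBall (0 : ℤ × ℤ) K).Finite := (isCompact_closedBall 0 K).finite_of_discrete
  have hpos : ∀ p : ℤ × ℤ, 0 < ‖z - latPt τ p‖ / (1 + ‖p‖) := by
    intro p
    have : z - latPt τ p ≠ 0 := fun h => hz ⟨p.1, p.2, by simpa [latPt] using sub_eq_zero.mp h⟩
    have := norm_pos_iff.mpr this
    positivity
  have hne : (Metric.closedBall (0 : ℤ × ℤ) K).Nonempty := ⟨0, by
    simp; positivity⟩
  obtain ⟨p0, hp0, hmin⟩ := Set.exists_min_image _ (fun p => ‖z - latPt τ p‖ / (1 + ‖p‖)) hfin hne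
  refine ⟨min (c / 2) (‖z - latPt τ p0‖ / (1 + ‖p0‖) ), lt_min (by positivity) (hpos p0), fun p => ?_⟩
  by_cases hp : p ∈ Metric.closedBall (0 : ℤ × ℤ) K
  · have := hmin p hp
    rw [← le_div_iff₀ (by positivity)]
    exact (min_le_right _ _).trans this
  · have hp' : K < ‖p‖ := by simpa using hp
    rw [hK, div_lt_iff₀ hc] at hp'
    have h1 : ‖latPt τ p‖ - ‖z‖ ≤ ‖z - latPt τ p‖ := by
      rw [norm_sub_rev]; exact norm_sub_norm_le _ _
    have h2 := h p
    calc _ ≤ (c / 2) * (1 + ‖p‖) := by gcongr; exact min_le_left _ _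
      _ ≤ _ := by linarith

lemma aux_unif (τ : ℂ) (hτ : 0 < τ.im) (z : ℂ) (hz : ¬ lat τ z) :
    ∃ c > 0, ∃ ε > 0, ∀ x ∈ Metric.ball (τ, z) ε, ∀ p : ℤ × ℤ,
      c * (1 + ‖p‖) ≤ ‖x.2 - latPt x.1 p‖ ∧ (p ≠ 0 → c * (1 + ‖p‖) ≤ ‖latPt x.1 p‖) := by
  obtain ⟨c1, hc1, h1⟩ := aux_lowbd τ hτ
  obtain ⟨c2, hc2, h2⟩ := aux_lowbd2 τ hτ z hz
  set c := min (c1 / 2) c2 with hc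
  have hc0 : 0 < c := by positivity
  refine ⟨c / 2, by positivity, c / 2, by positivity, fun x hx p => ?_⟩
  rw [mem_ball_iff_norm, Prod.norm_def, max_lt_iff] at hx
  obtain ⟨hx1, hx2⟩ := hx
  simp only [Prod.fst_sub, Prod.snd_sub] at hx1 hx2
  constructor
  · have a := aux_latPt_shift τ x.1 z x.2 p _ hx1.le hx2.le
    have b := h2 p
    have d : ‖z - latPt τ p‖ - ‖(x.2 - latPt x.1 p) - (z - latPt τ p)‖ ≤ ‖x.2 - latPt x.1 p‖ := by
      have := norm_sub_le (x.2 - latPt x.1 p) ((x.2 - latPt x.1 p) - (z - latPt τ p))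
      rw [sub_sub_cancel] at this
      linarith
    have e : c * (1 + ‖p‖) ≤ c2 * (1 + ‖p‖) := by gcongr; exact min_le_right _ _
    linarith
  · intro hp
    have a := aux_latPt_shift τ x.1 0 0 p _ hx1.le (by simp; positivity)
    have b := h1 p
    have d : ‖latPt τ p‖ - ‖(0 - latPt x.1 p) - (0 - latPt τ p)‖ ≤ ‖latPt x.1 p‖ := by
      have := norm_sub_le (0 - latPt x.1 p) ((0 - latPt x.1 p) - (0 - latPt τ p))
      rw [sub_sub_cancel, zero_sub, zero_sub, norm_neg, norm_neg] at this
      simp only [zero_sub]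
      linarith
    have f := aux_one_le_norm p hp
    have e : c * (1 + ‖p‖) ≤ c1 / 2 * (1 + ‖p‖) := by gcongr; exact min_le_left _ _
    nlinarith

open Filter Topology in
lemma aux_open (τ : ℂ) (hτ : 0 < τ.im) (z : ℂ) (hz : ¬ lat τ z) :
    ∀ᶠ x : ℂ × ℂ in 𝓝 (τ, z), 0 < x.1.im ∧ ¬ lat x.1 x.2 := by
  obtain ⟨c, hc, ε, hε, h⟩ := aux_unif τ hτ z hz
  have h1 : ∀ᶠ x : ℂ × ℂ in 𝓝 (τ, z), 0 < x.1.im :=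
    (isOpen_lt continuous_const (Complex.continuous_im.comp continuous_fst)).mem_nhds hτ
  filter_upwards [h1, Metric.ball_mem_nhds _ hε] with x hx1 hx2
  refine ⟨hx1, ?_⟩
  rintro ⟨m, n, e⟩
  have := (h x hx2 (m, n)).1
  rw [e] at this
  simp only [latPt, sub_self, norm_zero] at this
  have : 0 < c * (1 + ‖(m, n)‖) := by positivity
  linarith

lemma aux_summable_u : Summable (fun p : ℤ × ℤ => ((1 + ‖p‖) ^ 3)⁻¹) := by
  have h := EisensteinSeries.summable_one_div_norm_rpow (k := 3) (by norm_num)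
  rw [← (finTwoArrowEquiv _).symm.summable_iff] at h
  refine Summable.of_norm_bounded_eventually h ?_
  rw [Filter.eventually_cofinite]
  refine (Set.finite_singleton (0 : ℤ × ℤ)).subset fun p hp => ?_
  by_contra hne
  apply hp
  have h1 := aux_one_le_norm p hne
  have e : ‖(finTwoArrowEquiv ℤ).symm p‖ = ‖p‖ := by
    rw [EisensteinSeries.norm_eq_max_natAbs, Prod.norm_def]
    simp [Int.norm_eq_abs]
  simp only [Function.comp, e]
  rw [Real.rpow_neg (by positivity), norm_inv, norm_pow, Real.norm_of_nonneg (by positivity)]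
  norm_cast
  gcongr
  linarith

/-- term of the zeta series -/
def zterm (p : ℤ × ℤ) (x : ℂ × ℂ) : ℂ :=
  1 / (x.2 - latPt x.1 p) + 1 / latPt x.1 p + x.2 / (latPt x.1 p) ^ 2

lemma aux_bd_gen (c s A : ℝ) (hc : 0 < c) (hs : 0 < s) (a : ℂ) (h : c * s ≤ ‖a‖) : ‖a⁻¹‖ ≤ (c * s)⁻¹ := by
  rw [norm_inv]; gcongr

lemma zterm_bound (c : ℝ) (hc : 0 < c) (p : ℤ × ℤ) (x : ℂ × ℂ)
    (h1 : c * (1 + ‖p‖) ≤ ‖x.2 - latPt x.1 p‖) (h2 : c * (1 + ‖p‖) ≤ ‖latPt x.1 p‖) :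
    ‖zterm p x‖ ≤ ‖x.2‖ ^ 2 * (c ^ 3)⁻¹ * ((1 + ‖p‖) ^ 3)⁻¹ := by
  have hs : 0 < c * (1 + ‖p‖) := by positivity
  have n1 : x.2 - latPt x.1 p ≠ 0 := norm_pos_iff.mp (hs.trans_le h1)
  have n2 : latPt x.1 p ≠ 0 := norm_pos_iff.mp (hs.trans_le h2)
  have e : zterm p x = x.2 ^ 2 * ((latPt x.1 p)⁻¹ ^ 2 * (x.2 - latPt x.1 p)⁻¹) := by
    rw [zterm]; field_simp; ring
  have b1 := aux_bd_gen c (1 + ‖p‖) 0 hc (by positivity) _ h1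
  have b2 := aux_bd_gen c (1 + ‖p‖) 0 hc (by positivity) _ h2
  rw [e, norm_mul, norm_mul, norm_pow, norm_pow]
  calc _ ≤ ‖x.2‖ ^ 2 * ((c * (1 + ‖p‖))⁻¹ ^ 2 * (c * (1 + ‖p‖))⁻¹) := by gcongr
    _ = _ := by field_simp

/-- derivative of the term -/
def zterm' (p : ℤ × ℤ) (x : ℂ × ℂ) : ℂ × ℂ →L[ℂ] ℂ :=
  ((p.2 : ℂ) * (1 / (x.2 - latPt x.1 p) ^ 2 - 1 / (latPt x.1 p) ^ 2 - 2 * x.2 / (latPt x.1 p) ^ 3)) •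
      ContinuousLinearMap.fst ℂ ℂ ℂ +
  (-1 / (x.2 - latPt x.1 p) ^ 2 + 1 / (latPt x.1 p) ^ 2) • ContinuousLinearMap.snd ℂ ℂ ℂ

lemma zterm_hasFDerivAt (p : ℤ × ℤ) (x : ℂ × ℂ) (n1 : x.2 - latPt x.1 p ≠ 0) (n2 : latPt x.1 p ≠ 0) :
    HasFDerivAt (zterm p) (zterm' p x) x := by
  have hf : HasFDerivAt (fun x : ℂ × ℂ => x.1) (ContinuousLinearMap.fst ℂ ℂ ℂ) x := hasFDerivAt_fst
  have hs : HasFDerivAt (fun x : ℂ × ℂ => x.2) (ContinuousLinearMap.snd ℂ ℂ ℂ) x := hasFDerivAt_snd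
  have hl : HasFDerivAt (fun x : ℂ × ℂ => latPt x.1 p) ((p.2 : ℂ) • ContinuousLinearMap.fst ℂ ℂ ℂ) x :=
    (hf.const_mul (p.2 : ℂ)).const_add (p.1 : ℂ)
  have hi := (hasDerivAt_inv n2).comp_hasFDerivAt x hl
  have hj := (hasDerivAt_inv n1).comp_hasFDerivAt x (hs.sub hl)
  have hk := hs.mul (hi.pow 2)
  refine ((hj.add hi).add hk).congr_of_eventuallyEq (Filter.Eventually.of_forall fun y => ?_) |>.congr_fderiv ?_
  · simp [zterm, div_eq_mul_inv]
  · ext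
    · simp [zterm']
      field_simp
      ring
    · simp [zterm']
      field_simp
      try ring

lemma zterm'_bound (c Z : ℝ) (hc : 0 < c) (p : ℤ × ℤ) (x : ℂ × ℂ) (hZ : ‖x.2‖ ≤ Z)
    (h1 : c * (1 + ‖p‖) ≤ ‖x.2 - latPt x.1 p‖) (h2 : c * (1 + ‖p‖) ≤ ‖latPt x.1 p‖) :
    ‖zterm' p x‖ ≤ (3 * Z ^ 2 * (c ^ 4)⁻¹ + 2 * Z * (c ^ 3)⁻¹) * ((1 + ‖p‖) ^ 3)⁻¹ := by
  have hs : 0 < c * (1 + ‖p‖) := by positivity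
  have n1 : x.2 - latPt x.1 p ≠ 0 := norm_pos_iff.mp (hs.trans_le h1)
  have n2 : latPt x.1 p ≠ 0 := norm_pos_iff.mp (hs.trans_le h2)
  have b1 := aux_bd_gen c (1 + ‖p‖) 0 hc (by positivity) _ h1
  have b2 := aux_bd_gen c (1 + ‖p‖) 0 hc (by positivity) _ h2
  have hn : ‖(p.2 : ℂ)‖ ≤ 1 + ‖p‖ := by
    rw [Complex.norm_intCast, ← Int.norm_eq_abs]
    linarith [norm_snd_le p]
  have ea : (p.2 : ℂ) * (1 / (x.2 - latPt x.1 p) ^ 2 - 1 / (latPt x.1 p) ^ 2 - 2 * x.2 / (latPt x.1 p) ^ 3)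
      = p.2 * (x.2 ^ 2 * ((latPt x.1 p)⁻¹ ^ 2 * (x.2 - latPt x.1 p)⁻¹ ^ 2)
        - 2 * (x.2 ^ 2 * ((latPt x.1 p)⁻¹ ^ 3 * (x.2 - latPt x.1 p)⁻¹))) := by
    field_simp; ring
  have eb : -1 / (x.2 - latPt x.1 p) ^ 2 + 1 / (latPt x.1 p) ^ 2
      = x.2 * ((latPt x.1 p)⁻¹ ^ 2 * (x.2 - latPt x.1 p)⁻¹) -
        x.2 * ((latPt x.1 p)⁻¹ * (x.2 - latPt x.1 p)⁻¹ ^ 2) := by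
    field_simp; ring
  have hZ0 : 0 ≤ Z := (norm_nonneg _).trans hZ
  rw [zterm', ea, eb]
  generalize (latPt x.1 p)⁻¹ = u at *
  generalize (x.2 - latPt x.1 p)⁻¹ = v at *
  have hA : ‖(p.2 : ℂ) * (x.2 ^ 2 * (u ^ 2 * v ^ 2) - 2 * (x.2 ^ 2 * (u ^ 3 * v)))‖
      ≤ 3 * Z ^ 2 * (c ^ 4)⁻¹ * ((1 + ‖p‖) ^ 3)⁻¹ := by
    rw [norm_mul]
    calc _ ≤ (1 + ‖p‖) * (‖x.2 ^ 2 * (u ^ 2 * v ^ 2)‖ + ‖2 * (x.2 ^ 2 * (u ^ 3 * v))‖) := by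
          gcongr; exact norm_sub_le _ _
      _ ≤ (1 + ‖p‖) * (Z ^ 2 * ((c * (1 + ‖p‖))⁻¹ ^ 2 * (c * (1 + ‖p‖))⁻¹ ^ 2) +
            2 * (Z ^ 2 * ((c * (1 + ‖p‖))⁻¹ ^ 3 * (c * (1 + ‖p‖))⁻¹))) := by
          simp only [norm_mul, norm_pow, Complex.norm_ofNat]
          gcongr
      _ = _ := by field_simp; ring
  have hB : ‖x.2 * (u ^ 2 * v) - x.2 * (u * v ^ 2)‖ ≤ 2 * Z * (c ^ 3)⁻¹ * ((1 + ‖p‖) ^ 3)⁻¹ := by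
    calc _ ≤ ‖x.2 * (u ^ 2 * v)‖ + ‖x.2 * (u * v ^ 2)‖ := norm_sub_le _ _
      _ ≤ Z * ((c * (1 + ‖p‖))⁻¹ ^ 2 * (c * (1 + ‖p‖))⁻¹) +
            Z * ((c * (1 + ‖p‖))⁻¹ * (c * (1 + ‖p‖))⁻¹ ^ 2) := by
          simp only [norm_mul, norm_pow]
          gcongr
      _ = _ := by field_simp; ring
  refine (norm_add_le _ _).trans ?_
  rw [norm_smul, norm_smul, add_mul]
  have f1 := ContinuousLinearMap.norm_fst_le ℂ ℂ ℂ
  have f2 := ContinuousLinearMap.norm_snd_le ℂ ℂ ℂ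
  exact add_le_add ((mul_le_of_le_one_right (norm_nonneg _) f1).trans hA)
    ((mul_le_of_le_one_right (norm_nonneg _) f2).trans hB)

lemma zterm_summable (τ : ℂ) (hτ : 0 < τ.im) (z : ℂ) (hz : ¬ lat τ z) :
    Summable (fun p : ℤ × ℤ => zterm p (τ, z)) := by
  obtain ⟨c, hc, ε, hε, h⟩ := aux_unif τ hτ z hz
  refine Summable.of_norm_bounded_eventually (aux_summable_u.mul_left (‖z‖ ^ 2 * (c ^ 3)⁻¹)) ?_
  rw [Filter.eventually_cofinite]
  refine (Set.finite_singleton (0 : ℤ × ℤ)).subset fun p hp => ?_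
  by_contra hne
  apply hp
  have := h (τ, z) (Metric.mem_ball_self hε) p
  exact zterm_bound c hc p (τ, z) this.1 (this.2 hne)

lemma aux_nonlat_ne (τ z : ℂ) (hz : ¬ lat τ z) : z ≠ 0 := by
  rintro rfl
  exact hz ⟨0, 0, by simp⟩

lemma wzeta_differentiableAt (τ : ℂ) (hτ : 0 < τ.im) (z : ℂ) (hz : ¬ lat τ z) :
    DifferentiableAt ℂ (fun x : ℂ × ℂ => wzeta x.1 x.2) (τ, z) := by
  obtain ⟨c, hc, ε, hε, h⟩ := aux_unif τ hτ z hz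
  have h0 : z ≠ 0 := aux_nonlat_ne τ z hz
  have A : DifferentiableAt ℂ (fun x : ℂ × ℂ => 1 / x.2) (τ, z) := by
    simp only [one_div]
    exact DifferentiableAt.fun_inv differentiableAt_snd h0
  have B : HasFDerivAt (fun x : ℂ × ℂ => ∑' p : {p : ℤ × ℤ // p ≠ 0}, zterm p x)
      (∑' p : {p : ℤ × ℤ // p ≠ 0}, zterm' p (τ, z)) (τ, z) := by
    refine hasFDerivAt_tsum_of_isPreconnected (s := Metric.ball (τ, z) ε) (x₀ := (τ, z))
      (u := fun p : {p : ℤ × ℤ // p ≠ 0} => (3 * (‖z‖ + ε) ^ 2 * (c ^ 4)⁻¹ + 2 * (‖z‖ + ε) * (c ^ 3)⁻¹) *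
        ((1 + ‖p.1‖) ^ 3)⁻¹) ?_ Metric.isOpen_ball
      (convex_ball _ _).isPreconnected ?_ ?_ (Metric.mem_ball_self hε) ?_ (Metric.mem_ball_self hε)
    · exact (aux_summable_u.subtype _).mul_left _
    · intro p x hx
      have hh := h x hx p
      have hs : 0 < c * (1 + ‖p.1‖) := by positivity
      exact zterm_hasFDerivAt _ _ (norm_pos_iff.mp (hs.trans_le hh.1))
        (norm_pos_iff.mp (hs.trans_le (hh.2 p.2)))
    · intro p x hx
      have hh := h x hx p
      refine zterm'_bound c _ hc p x ?_ hh.1 (hh.2 p.2)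
      rw [mem_ball_iff_norm, Prod.norm_def, max_lt_iff] at hx
      have := hx.2
      simp only [Prod.snd_sub] at this
      have := norm_sub_norm_le x.2 z
      linarith
    · exact (zterm_summable τ hτ z hz).subtype _
  exact A.add B.differentiableAt
lemma wzeta_hasSum (τ : ℂ) (hτ : 0 < τ.im) (z : ℂ) (hz : ¬ lat τ z) :
    HasSum (fun p : ℤ × ℤ => zterm p (τ, z)) (wzeta τ z) := by
  have hs := zterm_summable τ hτ z hz
  have e : wzeta τ z = ∑' p : ℤ × ℤ, zterm p (τ, z) := by
    have := hs.tsum_subtype_add_tsum_subtype_compl {0}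
    rw [← this, tsum_singleton (0 : ℤ × ℤ) (fun p => zterm p (τ, z))]
    simp [wzeta, zterm, latPt]
    rfl
  rw [e]
  exact hs.hasSum

/-- row sums -/
def zrow (τ z : ℂ) (n : ℤ) : ℂ := ∑' m : ℤ, zterm (m, n) (τ, z)

lemma zrow_summable (τ : ℂ) (hτ : 0 < τ.im) (z : ℂ) (hz : ¬ lat τ z) (n : ℤ) :
    Summable (fun m : ℤ => zterm (m, n) (τ, z)) :=
  (zterm_summable τ hτ z hz).comp_injective (i := fun m : ℤ => (m, n)) (fun a b h => by simpa using h)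

lemma zrow_hasSum (τ : ℂ) (hτ : 0 < τ.im) (z : ℂ) (hz : ¬ lat τ z) :
    HasSum (zrow τ z) (wzeta τ z) := by
  have h := (Equiv.prodComm ℤ ℤ).hasSum_iff.mpr (wzeta_hasSum τ hτ z hz)
  exact h.prod_fiberwise (fun n => (zrow_summable τ hτ z hz n).hasSum)

/-- `π cot (π w)` -/
def pcot (w : ℂ) : ℂ := Real.pi * Complex.cot (Real.pi * w)

open Filter Topology in
lemma pcot_tendsto (w : ℂ) (hw : w ∈ integerComplement) :
    Tendsto (fun N : ℕ => ∑ m ∈ Finset.Icc (-(N : ℤ)) N, 1 / (w - m)) atTop (𝓝 (pcot w)) := by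
  have h := (tendsto_logDeriv_euler_cot_sub hw).const_add (1 / w)
  have e : 1 / w + (Real.pi * Complex.cot (Real.pi * w) - 1 / w) = pcot w := by
    rw [pcot]; ring
  rw [e] at h
  refine h.congr fun N => ?_
  induction N with
  | zero => simp
  | succ N ih =>
    rw [Finset.sum_range_succ, ← add_assoc, ih]
    have := Finset.sum_Icc_succ_eq_add_endpoints (fun m : ℤ => 1 / (w - m)) (N := N)
    push_cast at this ⊢
    rw [this, cotTerm]
    ring

lemma aux_compl (τ z : ℂ) (hz : ¬ lat τ z) (n : ℤ) : z - n * τ ∈ integerComplement := by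
  rw [mem_integerComplement_iff]
  rintro ⟨m, hm⟩
  exact hz ⟨m, n, by rw [hm]; ring⟩

/-- row Eisenstein sum -/
def erow (τ : ℂ) (n : ℤ) : ℂ := ∑' m : ℤ, 1 / (latPt τ (m, n)) ^ 2

lemma erow_summable (τ : ℂ) (n : ℤ) : Summable (fun m : ℤ => 1 / (latPt τ (m, n)) ^ 2) := by
  refine (EisensteinSeries.linear_right_summable τ n (k := 2) le_rfl).congr fun m => ?_
  rw [latPt, one_div, add_comm]
  norm_cast

open Filter Topology in
lemma aux_tendsto_Icc {f : ℤ → ℂ} {a : ℂ} (h : HasSum f a) :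
    Tendsto (fun N : ℕ => ∑ m ∈ Finset.Icc (-(N : ℤ)) N, f m) atTop (𝓝 a) := by
  have h' : Tendsto (fun s : Finset ℤ => ∑ m ∈ s, f m) atTop (𝓝 a) := by simpa [HasSum] using h
  exact h'.comp Finset.tendsto_Icc_neg

lemma zrow_diff (τ : ℂ) (hτ : 0 < τ.im) (z w : ℂ) (hz : ¬ lat τ z) (hw : ¬ lat τ w) (n : ℤ) :
    zrow τ w n - zrow τ z n = pcot (w - n * τ) - pcot (z - n * τ) + (w - z) * erow τ n := by
  have h1 := aux_tendsto_Icc ((zrow_summable τ hτ w hw n).hasSum.sub (zrow_summable τ hτ z hz n).hasSum)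
  have h2 := ((pcot_tendsto _ (aux_compl τ w hw n)).sub (pcot_tendsto _ (aux_compl τ z hz n))).add
    ((aux_tendsto_Icc (erow_summable τ n).hasSum).const_mul (w - z))
  refine tendsto_nhds_unique h1 (h2.congr fun N => ?_)
  rw [← Finset.sum_sub_distrib, Finset.mul_sum, ← Finset.sum_add_distrib]
  refine Finset.sum_congr rfl fun m _ => ?_
  have e1 : w - n * τ - m = w - (m + n * τ) := by ring
  have e2 : z - n * τ - m = z - (m + n * τ) := by ring
  simp only [zterm, latPt, e1, e2]
  ring

open Filter Topology in
lemma wzeta_diff_tendsto (τ : ℂ) (hτ : 0 < τ.im) (z w : ℂ) (hz : ¬ lat τ z) (hw : ¬ lat τ w) :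
    Tendsto (fun N : ℕ => ∑ n ∈ Finset.Icc (-(N : ℤ)) N, (pcot (w - n * τ) - pcot (z - n * τ)) +
      (w - z) * ∑ n ∈ Finset.Icc (-(N : ℤ)) N, erow τ n) atTop (𝓝 (wzeta τ w - wzeta τ z)) := by
  refine (aux_tendsto_Icc ((zrow_hasSum τ hτ w hw).sub (zrow_hasSum τ hτ z hz))).congr fun N => ?_
  simp only [zrow_diff τ hτ z w hz hw]
  rw [Finset.sum_add_distrib, Finset.mul_sum]

lemma pcot_add_one (w : ℂ) : pcot (w + 1) = pcot w := by
  rw [pcot, pcot, Complex.cot_pi_eq_exp_ratio, Complex.cot_pi_eq_exp_ratio]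
  have : Complex.exp (2 * Real.pi * Complex.I * (w + 1)) = Complex.exp (2 * Real.pi * Complex.I * w) := by
    rw [mul_add, mul_one, Complex.exp_periodic]
  rw [this]

lemma pcot_neg (w : ℂ) : pcot (-w) = - pcot w := by
  simp [pcot, Complex.cot, neg_div, div_neg]

lemma lat_add_one {τ z : ℂ} (hz : ¬ lat τ z) : ¬ lat τ (z + 1) := by
  rintro ⟨m, n, h⟩
  exact hz ⟨m - 1, n, by push_cast; linear_combination h⟩

lemma lat_add_tau {τ z : ℂ} (hz : ¬ lat τ z) : ¬ lat τ (z + τ) := by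
  rintro ⟨m, n, h⟩
  exact hz ⟨m, n - 1, by push_cast; linear_combination h⟩

lemma lat_half {τ : ℂ} (hτ : 0 < τ.im) : ¬ lat τ (1 / 2) := by
  rintro ⟨m, n, h⟩
  have h1 := congrArg Complex.im h
  have h2 := congrArg Complex.re h
  simp [hτ.ne'] at h1
  simp [h1] at h2
  have h3 : (2 * m : ℝ) = 1 := by rw [← h2]; norm_num
  norm_cast at h3
  omega

lemma lat_neg_half {τ : ℂ} (hτ : 0 < τ.im) : ¬ lat τ (-(1 / 2)) := by
  rintro ⟨m, n, h⟩
  exact lat_half hτ ⟨-m, -n, by push_cast; linear_combination -h⟩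

open Filter Topology in
lemma erow_tendsto (τ : ℂ) (hτ : 0 < τ.im) (z : ℂ) (hz : ¬ lat τ z) :
    Tendsto (fun N : ℕ => ∑ n ∈ Finset.Icc (-(N : ℤ)) N, erow τ n) atTop
      (𝓝 (wzeta τ (z + 1) - wzeta τ z)) := by
  refine (wzeta_diff_tendsto τ hτ z (z + 1) hz (lat_add_one hz)).congr fun N => ?_
  have : ∀ n : ℤ, z + 1 - n * τ = z - n * τ + 1 := fun n => by ring
  simp only [this, pcot_add_one]
  simp

lemma wzeta_add_one (τ : ℂ) (hτ : 0 < τ.im) (z : ℂ) (hz : ¬ lat τ z) :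
    wzeta τ (z + 1) - wzeta τ z = eta1 τ := by
  have := tendsto_nhds_unique (erow_tendsto τ hτ z hz) (erow_tendsto τ hτ _ (lat_neg_half hτ))
  rw [this, eta1]
  norm_num

open Filter Topology in
lemma pcot_lim (τ : ℂ) (hτ : 0 < τ.im) (w : ℂ) :
    Tendsto (fun N : ℕ => pcot (w + N * τ)) atTop (𝓝 (-(Real.pi * Complex.I))) := by
  have hq : Tendsto (fun N : ℕ => Complex.exp (2 * Real.pi * Complex.I * (w + N * τ))) atTop (𝓝 0) := by
    have e : ∀ N : ℕ, Complex.exp (2 * Real.pi * Complex.I * (w + N * τ)) =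
        Complex.exp (2 * Real.pi * Complex.I * w) * Complex.exp (2 * Real.pi * Complex.I * τ) ^ N := by
      intro N
      rw [← Complex.exp_nat_mul, ← Complex.exp_add]
      ring_nf
    simp only [e]
    have : ‖Complex.exp (2 * Real.pi * Complex.I * τ)‖ < 1 :=
      UpperHalfPlane.norm_exp_two_pi_I_lt_one ⟨τ, hτ⟩
    simpa using (tendsto_pow_atTop_nhds_zero_of_norm_lt_one this).const_mul
      (Complex.exp (2 * Real.pi * Complex.I * w))
  have h := ((hq.add_const 1).div ((hq.const_sub 1).const_mul Complex.I) (by simp)).const_mul (Real.pi : ℂ)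
  have e : (Real.pi : ℂ) * ((0 + 1) / (Complex.I * (1 - 0))) = -(Real.pi * Complex.I) := by
    simp
  rw [e] at h
  refine h.congr fun N => ?_
  rw [pcot, Complex.cot_pi_eq_exp_ratio]
  rfl

open Filter Topology in
lemma wzeta_add_tau (τ : ℂ) (hτ : 0 < τ.im) (z : ℂ) (hz : ¬ lat τ z) :
    wzeta τ (z + τ) - wzeta τ z = -i2pi + τ * eta1 τ := by
  have h1 := wzeta_diff_tendsto τ hτ z (z + τ) hz (lat_add_tau hz)
  have h2 := erow_tendsto τ hτ z hz
  rw [wzeta_add_one τ hτ z hz] at h2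
  have h3 := ((pcot_lim τ hτ (z + τ)).add (pcot_lim τ hτ (-z))).add (h2.const_mul τ)
  have e : -(Real.pi * Complex.I) + -(Real.pi * Complex.I) + τ * eta1 τ = -i2pi + τ * eta1 τ := by
    rw [i2pi]; ring
  rw [e] at h3
  refine tendsto_nhds_unique h1 (h3.congr fun N => ?_)
  have t : ∀ N : ℕ, pcot (z + τ + N * τ) + pcot (-z + N * τ) =
      ∑ n ∈ Finset.Icc (-(N : ℤ)) N, (pcot (z + τ - n * τ) - pcot (z - n * τ)) := by
    intro N
    have hn : ∀ N : ℕ, pcot (-z + N * τ) = - pcot (z - N * τ) := by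
      intro N
      rw [← pcot_neg]; congr 1; ring
    simp only [hn]
    induction N with
    | zero => simp; ring
    | succ N ih =>
      have := Finset.sum_Icc_succ_eq_add_endpoints
        (fun n : ℤ => pcot (z + τ - n * τ) - pcot (z - n * τ)) (N := N)
      push_cast at this ih ⊢
      rw [this, ← ih]
      have a1 : z + τ - (N + 1) * τ = z - N * τ := by ring
      have a2 : z + τ - (-1 + -N) * τ = z + τ + (N + 1) * τ := by ring
      have a3 : z - (-1 + -N) * τ = z + τ + N * τ := by ring
      have a2' : z + τ - (-((N : ℂ) + 1)) * τ = z + τ + (N + 1) * τ := by ring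
      have a3' : z - (-((N : ℂ) + 1)) * τ = z + τ + N * τ := by ring
      simp only [a1, a2, a3, a2', a3']
      ring
  rw [t]
  ring

lemma i2pi_ne : i2pi ≠ 0 := by
  simp [i2pi, Real.pi_ne_zero]

lemma zeta1_add_one (τ : ℂ) (hτ : 0 < τ.im) (z : ℂ) (hz : ¬ lat τ z) :
    zeta1 τ (z + 1) = zeta1 τ z := by
  rw [zeta1, zeta1]
  congr 1
  linear_combination wzeta_add_one τ hτ z hz

lemma zeta1_add_tau (τ : ℂ) (hτ : 0 < τ.im) (z : ℂ) (hz : ¬ lat τ z) :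
    zeta1 τ (z + τ) = zeta1 τ z + 1 := by
  have h := wzeta_add_tau τ hτ z hz
  have h0 := i2pi_ne
  rw [zeta1, zeta1]
  have e : wzeta τ (z + τ) = wzeta τ z + (-i2pi + τ * eta1 τ) := by rw [← h]; ring
  rw [e]
  field_simp
  ring

lemma eta1_differentiableAt (τ : ℂ) (hτ : 0 < τ.im) : DifferentiableAt ℂ eta1 τ := by
  have key : ∀ a : ℂ, ¬ lat τ a → DifferentiableAt ℂ (fun t => wzeta t a) τ := by
    intro a ha
    exact (wzeta_differentiableAt τ hτ a ha).comp τ (f := fun t : ℂ => (t, a))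
      (differentiableAt_id.prodMk (differentiableAt_const a))
  exact (key _ (lat_half hτ)).sub (key _ (lat_neg_half hτ))

lemma zeta1_differentiableAt (τ : ℂ) (hτ : 0 < τ.im) (z : ℂ) (hz : ¬ lat τ z) :
    DifferentiableAt ℂ (fun x : ℂ × ℂ => zeta1 x.1 x.2) (τ, z) := by
  have h1 := wzeta_differentiableAt τ hτ z hz
  have h2 : DifferentiableAt ℂ (fun x : ℂ × ℂ => eta1 x.1) (τ, z) :=
    (eta1_differentiableAt τ hτ).comp (τ, z) (f := fun x : ℂ × ℂ => x.1) differentiableAt_fst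
  exact (h1.sub (h2.mul differentiableAt_snd)).const_mul _

/-- `Ψ₁` and `Ψ₂` are invariant under the two transformations
`(z,θ) ↦ (z+1,θ)` and `(z,θ) ↦ (z+τ+θφ, θ+φ)`. -/
theorem Psi_invariance (τ : ℂ) (hτ : 0 < τ.im) (z : ℂ) (hz : ¬ lat τ z) :
    SF.EqAt (T1 (Psi1 τ)) (Psi1 τ) z ∧ SF.EqAt (T2 τ (Psi1 τ)) (Psi1 τ) z ∧
    SF.EqAt (T1 (Psi2 τ)) (Psi2 τ) z ∧ SF.EqAt (T2 τ (Psi2 τ)) (Psi2 τ) z := by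
  have hopen := aux_open τ hτ z hz
  have evz : ∀ᶠ w in nhds z, ¬ lat τ w := by
    have : Filter.Tendsto (fun w : ℂ => (τ, w)) (nhds z) (nhds (τ, z)) :=
      (Continuous.prodMk_right τ).tendsto z
    exact (this.eventually hopen).mono fun w hw => hw.2
  have evt : ∀ᶠ t in nhds τ, 0 < t.im ∧ ¬ lat t z := by
    have : Filter.Tendsto (fun t : ℂ => (t, z)) (nhds τ) (nhds (τ, z)) :=
      (Continuous.prodMk_left z).tendsto τ
    exact this.eventually hopen
  have d1 : deriv (zeta1 τ) (z + 1) = deriv (zeta1 τ) z := by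
    rw [← deriv_comp_add_const]
    exact Filter.EventuallyEq.deriv_eq (evz.mono fun w hw => zeta1_add_one τ hτ w hw)
  have d2 : deriv (zeta1 τ) (z + τ) = deriv (zeta1 τ) z := by
    rw [← deriv_comp_add_const, ← deriv_add_const (f := zeta1 τ) (c := (1 : ℂ))]
    exact Filter.EventuallyEq.deriv_eq (evz.mono fun w hw => zeta1_add_tau τ hτ w hw)
  have d3 : deriv (fun t => zeta1 t (z + 1)) τ = deriv (fun t => zeta1 t z) τ :=
    Filter.EventuallyEq.deriv_eq (evt.mono fun t ht => zeta1_add_one t ht.1 z ht.2)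
  have d4 : deriv (fun t => zeta1 t (z + τ)) τ + deriv (zeta1 τ) (z + τ) =
      deriv (fun t => zeta1 t z) τ := by
    have hG := (zeta1_differentiableAt τ hτ (z + τ) (lat_add_tau hz)).hasFDerivAt
    set L := fderiv ℂ (fun x : ℂ × ℂ => zeta1 x.1 x.2) (τ, z + τ)
    have a1 : HasDerivAt (fun t => zeta1 t (z + τ)) (L (1, 0)) τ :=
      hG.comp_hasDerivAt (f := fun t : ℂ => (t, z + τ)) τ
        ((hasDerivAt_id τ).prodMk (hasDerivAt_const τ (z + τ)))
    have a2 : HasDerivAt (zeta1 τ) (L (0, 1)) (z + τ) :=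
      hG.comp_hasDerivAt (f := fun w : ℂ => (τ, w)) (z + τ)
        ((hasDerivAt_const (z + τ) τ).prodMk (hasDerivAt_id (z + τ)))
    have a3 : HasDerivAt (fun t => zeta1 t (z + t)) (L (1, 1)) τ :=
      hG.comp_hasDerivAt (f := fun t : ℂ => (t, z + t)) τ
        ((hasDerivAt_id τ).prodMk ((hasDerivAt_id τ).const_add z))
    have a4 : deriv (fun t => zeta1 t (z + t)) τ = deriv (fun t => zeta1 t z) τ := by
      rw [← deriv_add_const (f := fun t => zeta1 t z) (c := (1 : ℂ))]
      exact Filter.EventuallyEq.deriv_eq (evt.mono fun t ht => zeta1_add_tau t ht.1 z ht.2)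
    rw [← a4, a1.deriv, a2.deriv, a3.deriv, ← map_add]
    simp
  refine ⟨⟨rfl, ?_, rfl, rfl⟩, ⟨rfl, ?_, rfl, ?_⟩, ⟨rfl, ?_, ?_, rfl⟩, ⟨rfl, ?_, ?_, ?_⟩⟩
  · simp [T1, Psi1, zeta1_add_one τ hτ z hz]
  · simp [T2, Psi1, zeta1_add_tau τ hτ z hz]
  · simp [T2, Psi1]
  · exact d3
  · exact d1
  · exact d4
  · exact d2
  · simp [T2, Psi2]
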